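/- Let 0<q<1 be real, let h̃1,…,h̃4,l̃1,…,l̃4,α̃,μ0,α be real numbers and t1,t2,t3,t4 nonzero complex numbers. Set χ = (h̃1+h̃2+h̃3+h̃4−l̃1−l̃2−l̃3−l̃4)/2, ν = 2μ0+α−α̃+χ, μ = μ0+χ+1, l_i = h̃_i+μ0 and h_i = l̃_i+μ0+χ for i=1,2,3,4. Let P be a function of two nonzero complex variables satisfying, for all nonzero x,s: P(x,s/q) = P(qx,s), P(x,qs) = P(x/q,s), (x−q^{μ0−1}s)P(x,s/q) = (x−q^{μ−1}s)P(x,s), and (x−q^{μ}s)P(x,qs) = (x−q^{μ0}s)P(x,s). Define Φ(x,s) = x^{−α} s^{χ+1−α̃} P(x,s). Then for all nonzero x,s with x ≠ q^{μ0−1}s and x ≠ q^{μ}s, applying A⟨2⟩(x; h1,h2,h3,h4,l1,l2,l3,l4,α) to Φ in x equals q^{ν} times applying A⟨2⟩(s; h̃1,h̃2,h̃3,h̃4,l̃1,l̃2,l̃3,l̃4,α̃) to Φ in s. -/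

import Mathlib

open Filter Topology

/-- The infinite q-Pochhammer symbol `(a;q)_∞ = ∏_{j=0}^∞ (1 - q^j a)`. -/
noncomputable def qPochInf (q : ℝ) (a : ℂ) : ℂ := ∏' j : ℕ, (1 - (q : ℂ) ^ j * a)

/-- `q^r` for a real exponent `r`, using the principal branch of the complex power. -/
noncomputable def qpow (q : ℝ) (r : ℝ) : ℂ := (q : ℂ) ^ (r : ℂ)

/-- The second degenerate Ruijsenaars–van Diejen operator `A⟨2⟩` applied to `g` at `x`. -/
noncomputable def A2 (q : ℝ) (t1 t2 t3 t4 : ℂ) (h1 h2 h3 h4 l1 l2 l3 l4 a : ℝ)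
    (g : ℂ → ℂ) (x : ℂ) : ℂ :=
  x⁻¹ ^ 2 * ((x - qpow q (h1 + 1/2) * t1) * (x - qpow q (h2 + 1/2) * t2) *
      (x - qpow q (h3 + 1/2) * t3) * (x - qpow q (h4 + 1/2) * t4)) * g (x / (q : ℂ))
    + qpow q (2*a + 1) * x⁻¹ ^ 2 *
        ((x - qpow q (l1 - 1/2) * t1) * (x - qpow q (l2 - 1/2) * t2) *
          (x - qpow q (l3 - 1/2) * t3) * (x - qpow q (l4 - 1/2) * t4)) * g ((q : ℂ) * x)
    + qpow q (a + 1/2) *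
        (-(qpow q (1/2) + qpow q (-(1/2))) * x ^ 2
          + ((qpow q h1 + qpow q l1) * t1 + (qpow q h2 + qpow q l2) * t2
              + (qpow q h3 + qpow q l3) * t3 + (qpow q h4 + qpow q l4) * t4) * x
          + (qpow q ((h1 + l1) / 2) * t1) * (qpow q ((h2 + l2) / 2) * t2) *
              (qpow q ((h3 + l3) / 2) * t3) * (qpow q ((h4 + l4) / 2) * t4) *
              (-(qpow q (1/2) + qpow q (-(1/2))) * x⁻¹ ^ 2
                + ((qpow q (-h1) * t1⁻¹ + qpow q (-l1) * t1⁻¹)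
                    + (qpow q (-h2) * t2⁻¹ + qpow q (-l2) * t2⁻¹)
                    + (qpow q (-h3) * t3⁻¹ + qpow q (-l3) * t3⁻¹)
                    + (qpow q (-h4) * t4⁻¹ + qpow q (-l4) * t4⁻¹)) * x⁻¹)) * g x

lemma qpow_ne_zero {q : ℝ} (hq : 0 < q) (r : ℝ) : qpow q r ≠ 0 := by
  simp [qpow, Complex.cpow_eq_zero_iff, hq.ne']

lemma qpow_add {q : ℝ} (hq : 0 < q) (r r' : ℝ) : qpow q (r + r') = qpow q r * qpow q r' := by
  simp only [qpow, Complex.ofReal_add]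
  exact Complex.cpow_add _ _ (by exact_mod_cast hq.ne')

lemma qpow_neg (q r : ℝ) : qpow q (-r) = (qpow q r)⁻¹ := by
  simp only [qpow, Complex.ofReal_neg, Complex.cpow_neg]

lemma qpow_half_sq {q : ℝ} (hq : 0 < q) : qpow q (1 / 2) ^ 2 = (q : ℂ) := by
  rw [sq, ← qpow_add hq]
  norm_num [qpow]

lemma mul_cpow_of_pos {q : ℝ} (hq : 0 < q) {x : ℂ} (hx : x ≠ 0) (b : ℝ) :
    ((q : ℂ) * x) ^ (b : ℂ) = qpow q b * x ^ (b : ℂ) := by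
  have hqc : (q : ℂ) ≠ 0 := by exact_mod_cast hq.ne'
  rw [qpow, Complex.cpow_def_of_ne_zero (mul_ne_zero hqc hx), Complex.cpow_def_of_ne_zero hqc,
    Complex.cpow_def_of_ne_zero hx, Complex.log_ofReal_mul hq hx, ← Complex.exp_add,
    Complex.ofReal_log hq.le, add_mul]

lemma div_cpow_of_pos {q : ℝ} (hq : 0 < q) {x : ℂ} (hx : x ≠ 0) (b : ℝ) :
    (x / (q : ℂ)) ^ (b : ℂ) = (qpow q b)⁻¹ * x ^ (b : ℂ) := by
  have hqc : (q : ℂ) ≠ 0 := by exact_mod_cast hq.ne'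
  have h := mul_cpow_of_pos hq (div_ne_zero hx hqc) b
  rw [mul_div_cancel₀ x hqc] at h
  rw [h, inv_mul_cancel_left₀ (qpow_ne_zero hq b)]

/-- The operator `A⟨2⟩` in terms of the zeros `v n` and `u n` of its shift coefficients. -/
lemma A2_eq_of_zeros {q : ℝ} (hq : 0 < q) (t1 t2 t3 t4 : ℂ)
    (h1 h2 h3 h4 l1 l2 l3 l4 a : ℝ) (g : ℂ → ℂ) (x : ℂ)
    {r E u1 u2 u3 u4 v1 v2 v3 v4 : ℂ} (hr : r = qpow q (1 / 2))
    (hE : E = qpow q ((h1 + h2 + h3 + h4 + l1 + l2 + l3 + l4) / 2) * (t1 * t2 * t3 * t4))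
    (hv1 : v1 = qpow q (h1 + 1 / 2) * t1) (hv2 : v2 = qpow q (h2 + 1 / 2) * t2)
    (hv3 : v3 = qpow q (h3 + 1 / 2) * t3) (hv4 : v4 = qpow q (h4 + 1 / 2) * t4)
    (hu1 : u1 = qpow q (l1 - 1 / 2) * t1) (hu2 : u2 = qpow q (l2 - 1 / 2) * t2)
    (hu3 : u3 = qpow q (l3 - 1 / 2) * t3) (hu4 : u4 = qpow q (l4 - 1 / 2) * t4) :
    A2 q t1 t2 t3 t4 h1 h2 h3 h4 l1 l2 l3 l4 a g x =
      x⁻¹ ^ 2 * ((x - v1) * (x - v2) * (x - v3) * (x - v4)) * g (x / (q : ℂ))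
      + qpow q a ^ 2 * r ^ 2 * x⁻¹ ^ 2 * ((x - u1) * (x - u2) * (x - u3) * (x - u4))
          * g ((q : ℂ) * x)
      + qpow q a * r * (-(r + r⁻¹) * x ^ 2
          + ((v1 + v2 + v3 + v4) * r⁻¹ + (u1 + u2 + u3 + u4) * r) * x
          + E * (-(r + r⁻¹) * x⁻¹ ^ 2
            + ((v1⁻¹ + v2⁻¹ + v3⁻¹ + v4⁻¹) * r + (u1⁻¹ + u2⁻¹ + u3⁻¹ + u4⁻¹) * r⁻¹) * x⁻¹))
          * g x := by
  have hr0 : r ≠ 0 := hr ▸ qpow_ne_zero hq _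
  have hE' : E = (qpow q ((h1 + l1) / 2) * t1) * (qpow q ((h2 + l2) / 2) * t2) *
      (qpow q ((h3 + l3) / 2) * t3) * (qpow q ((h4 + l4) / 2) * t4) := by
    rw [hE, show (h1 + h2 + h3 + h4 + l1 + l2 + l3 + l4) / 2
      = (h1 + l1) / 2 + (h2 + l2) / 2 + (h3 + l3) / 2 + (h4 + l4) / 2 by ring]
    simp only [qpow_add hq]
    ring
  have hv : ∀ (h : ℝ) (t : ℂ), qpow q (h + 1 / 2) * t = qpow q h * r * t := fun h t => by
    rw [qpow_add hq, hr]
  have hu : ∀ (l : ℝ) (t : ℂ), qpow q (l - 1 / 2) * t = qpow q l * r⁻¹ * t := fun l t => by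
    rw [sub_eq_add_neg, qpow_add hq, qpow_neg, hr]
  have ha : qpow q (2 * a + 1) = qpow q a ^ 2 * r ^ 2 := by
    rw [hr, sq, sq, ← qpow_add hq, ← qpow_add hq, ← qpow_add hq]
    ring_nf
  rw [A2, ← hE', ha, ← hv1, ← hv2, ← hv3, ← hv4, ← hu1, ← hu2, ← hu3, ← hu4,
    qpow_add hq a, qpow_neg q (1 / 2), ← hr]
  rw [hv] at hv1 hv2 hv3 hv4
  rw [hu] at hu1 hu2 hu3 hu4
  congr 3
  have key : ∀ (h l : ℝ) (t : ℂ), qpow q (-h) * t⁻¹ + qpow q (-l) * t⁻¹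
      = (qpow q h * r * t)⁻¹ * r + (qpow q l * r⁻¹ * t)⁻¹ * r⁻¹ := fun h l t => by
    simp only [qpow_neg, mul_inv, inv_inv]
    field_simp
  have key' : ∀ (h l : ℝ) (t : ℂ), (qpow q h + qpow q l) * t
      = (qpow q h * r * t) * r⁻¹ + (qpow q l * r⁻¹ * t) * r := fun h l t => by
    field_simp
  simp only [key, key', ← hv1, ← hv2, ← hv3, ← hv4, ← hu1, ← hu2, ← hu3, ← hu4]
  ring

/-- The kernel identity, with the quartics `∏ (X - u n)` and `∏ (X - v n)` given by their
coefficients; the constant terms are `E * S / S'` and `E * S' / S`. -/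
lemma kernel_identity_coeff {r x S S' : ℂ} (E e1 e2 e3 d1 d2 d3 p pp pm : ℂ)
    (hr : r ≠ 0) (hx : x ≠ 0) (hS : S ≠ 0) (hS' : S' ≠ 0)
    (hxS : x - S ≠ 0) (hxS' : x - S' ≠ 0)
    (hpp : (x - S) * pp = (x - S' / r ^ 2) * p) (hpm : (x - S') * pm = (x - r ^ 2 * S) * p) :
    x⁻¹ ^ 2 * (x ^ 4 - d1 * x ^ 3 + d2 * x ^ 2 - d3 * x + E * S' / S) * pm
      + r ^ 2 * x⁻¹ ^ 2 * (x ^ 4 - e1 * x ^ 3 + e2 * x ^ 2 - e3 * x + E * S / S') * pp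
      + r * (-(r + r⁻¹) * x ^ 2 + (d1 * r⁻¹ + e1 * r) * x - E * (r + r⁻¹) * x⁻¹ ^ 2
        + (d3 * S / S' * r + e3 * S' / S * r⁻¹) * x⁻¹) * p
    = r ^ 2 * S⁻¹ ^ 2 * (S ^ 4 - e1 * S ^ 3 + e2 * S ^ 2 - e3 * S + E * S / S') * pp
      + S'⁻¹ ^ 2 * (S' ^ 4 - d1 * S' ^ 3 + d2 * S' ^ 2 - d3 * S' + E * S' / S) * pm
      + r * (-(r + r⁻¹) * (S * S') + (e1 * S' * r⁻¹ + d1 * S * r)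
        - E * (r + r⁻¹) / (S * S') + (e3 * r / S + d3 * r⁻¹ / S')) * p := by
  obtain rfl : pp = (x - S' / r ^ 2) * p / (x - S) := by
    rw [← hpp, mul_div_cancel_left₀ _ hxS]
  obtain rfl : pm = (x - r ^ 2 * S) * p / (x - S') := by
    rw [← hpm, mul_div_cancel_left₀ _ hxS']
  field_simp
  ring

lemma mul_sum_inv_eq {u1 u2 u3 u4 E c : ℂ} (hu1 : u1 ≠ 0) (hu2 : u2 ≠ 0) (hu3 : u3 ≠ 0)
    (hu4 : u4 ≠ 0) (hE : E = u1 * u2 * u3 * u4 * c) :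
    E * (u1⁻¹ + u2⁻¹ + u3⁻¹ + u4⁻¹)
      = (u1 * u2 * u3 + u1 * u2 * u4 + u1 * u3 * u4 + u2 * u3 * u4) * c := by
  subst hE
  field_simp
  ring

lemma prod_sub_scale {s S : ℂ} (hS : S ≠ 0) (u1 u2 u3 u4 : ℂ) :
    (s - u1 * (s / S)) * (s - u2 * (s / S)) * (s - u3 * (s / S)) * (s - u4 * (s / S))
      = (s / S) ^ 4 * ((S - u1) * (S - u2) * (S - u3) * (S - u4)) := by
  field_simp

/-- The kernel identity in terms of the zeros of the shift coefficients. -/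
lemma kernel_identity {r x s S S' E u1 u2 u3 u4 v1 v2 v3 v4 p pp pm : ℂ}
    (hr : r ≠ 0) (hx : x ≠ 0) (hs : s ≠ 0) (hS : S ≠ 0) (hS' : S' ≠ 0)
    (hxS : x - S ≠ 0) (hxS' : x - S' ≠ 0)
    (hu1 : u1 ≠ 0) (hu2 : u2 ≠ 0) (hu3 : u3 ≠ 0) (hu4 : u4 ≠ 0)
    (hv1 : v1 ≠ 0) (hv2 : v2 ≠ 0) (hv3 : v3 ≠ 0) (hv4 : v4 ≠ 0)
    (hEu : E = u1 * u2 * u3 * u4 * (S' / S)) (hEv : E = v1 * v2 * v3 * v4 * (S / S'))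
    (hpp : (x - S) * pp = (x - S' / r ^ 2) * p) (hpm : (x - S') * pm = (x - r ^ 2 * S) * p) :
    x⁻¹ ^ 2 * ((x - v1) * (x - v2) * (x - v3) * (x - v4)) * pm
      + r ^ 2 * x⁻¹ ^ 2 * ((x - u1) * (x - u2) * (x - u3) * (x - u4)) * pp
      + r * (-(r + r⁻¹) * x ^ 2
          + ((v1 + v2 + v3 + v4) * r⁻¹ + (u1 + u2 + u3 + u4) * r) * x
          + E * (-(r + r⁻¹) * x⁻¹ ^ 2
            + ((v1⁻¹ + v2⁻¹ + v3⁻¹ + v4⁻¹) * r + (u1⁻¹ + u2⁻¹ + u3⁻¹ + u4⁻¹) * r⁻¹) * x⁻¹)) * p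
    = S * S' / s ^ 2 *
      (r ^ 2 * (S / S') * s⁻¹ ^ 2 * ((s - u1 * (s / S)) * (s - u2 * (s / S))
          * (s - u3 * (s / S)) * (s - u4 * (s / S))) * pp
        + S' / S * s⁻¹ ^ 2 * ((s - v1 * (s / S')) * (s - v2 * (s / S'))
          * (s - v3 * (s / S')) * (s - v4 * (s / S'))) * pm
        + r * (-(r + r⁻¹) * s ^ 2
          + ((u1 * (s / S) + u2 * (s / S) + u3 * (s / S) + u4 * (s / S)) * r⁻¹
            + (v1 * (s / S') + v2 * (s / S') + v3 * (s / S') + v4 * (s / S')) * r) * s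
          + E * (s / S) ^ 2 * (s / S') ^ 2 * (-(r + r⁻¹) * s⁻¹ ^ 2
            + (((u1 * (s / S))⁻¹ + (u2 * (s / S))⁻¹ + (u3 * (s / S))⁻¹ + (u4 * (s / S))⁻¹) * r
              + ((v1 * (s / S'))⁻¹ + (v2 * (s / S'))⁻¹ + (v3 * (s / S'))⁻¹ + (v4 * (s / S'))⁻¹)
                * r⁻¹) * s⁻¹)) * p) := by
  have hu := mul_sum_inv_eq hu1 hu2 hu3 hu4 hEu
  have hv := mul_sum_inv_eq hv1 hv2 hv3 hv4 hEv
  have key := kernel_identity_coeff E (u1 + u2 + u3 + u4)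
    (u1 * u2 + u1 * u3 + u1 * u4 + u2 * u3 + u2 * u4 + u3 * u4)
    (u1 * u2 * u3 + u1 * u2 * u4 + u1 * u3 * u4 + u2 * u3 * u4) (v1 + v2 + v3 + v4)
    (v1 * v2 + v1 * v3 + v1 * v4 + v2 * v3 + v2 * v4 + v3 * v4)
    (v1 * v2 * v3 + v1 * v2 * v4 + v1 * v3 * v4 + v2 * v3 * v4) p pp pm
    hr hx hS hS' hxS hxS' hpp hpm
  have hu4' : E * S / S' = u1 * u2 * u3 * u4 := by rw [hEu]; field_simp
  have hv4' : E * S' / S = v1 * v2 * v3 * v4 := by rw [hEv]; field_simp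
  rw [hu4', hv4'] at key
  rw [prod_sub_scale hS, prod_sub_scale hS']
  simp only [mul_inv, ← add_mul]
  generalize u1⁻¹ + u2⁻¹ + u3⁻¹ + u4⁻¹ = U at hu ⊢
  generalize v1⁻¹ + v2⁻¹ + v3⁻¹ + v4⁻¹ = V at hv ⊢
  have hl : r * (-(r + r⁻¹) * x ^ 2
      + ((v1 + v2 + v3 + v4) * r⁻¹ + (u1 + u2 + u3 + u4) * r) * x
      + E * (-(r + r⁻¹) * x⁻¹ ^ 2 + (V * r + U * r⁻¹) * x⁻¹)) * p
      = r * (-(r + r⁻¹) * x ^ 2 + ((v1 + v2 + v3 + v4) * r⁻¹ + (u1 + u2 + u3 + u4) * r) * x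
        - E * (r + r⁻¹) * x⁻¹ ^ 2 + (E * V * r + E * U * r⁻¹) * x⁻¹) * p := by ring
  have hm : S * S' / s ^ 2 * (r * (-(r + r⁻¹) * s ^ 2
      + ((u1 + u2 + u3 + u4) * (s / S) * r⁻¹ + (v1 + v2 + v3 + v4) * (s / S') * r) * s
      + E * (s / S) ^ 2 * (s / S') ^ 2 * (-(r + r⁻¹) * s⁻¹ ^ 2
        + (U * (s / S)⁻¹ * r + V * (s / S')⁻¹ * r⁻¹) * s⁻¹)) * p)
      = r * (-(r + r⁻¹) * (S * S') + ((u1 + u2 + u3 + u4) * S' * r⁻¹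
        + (v1 + v2 + v3 + v4) * S * r) - E * (r + r⁻¹) / (S * S')
        + (E * U * r / S' + E * V * r⁻¹ / S)) * p := by
    field_simp
    ring
  have hsu : S * S' / s ^ 2 * (r ^ 2 * (S / S') * s⁻¹ ^ 2 * (s / S) ^ 4) = r ^ 2 * S⁻¹ ^ 2 := by
    field_simp
  have hsv : S * S' / s ^ 2 * (S' / S * s⁻¹ ^ 2 * (s / S') ^ 4) = S'⁻¹ ^ 2 := by
    field_simp
  rw [hl, mul_add (S * S' / s ^ 2), hm, hu, hv]
  have c1 : S' / S / S' = 1 / S := by field_simp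
  have c2 : S / S' / S = 1 / S' := by field_simp
  linear_combination key
    - ((S - u1) * (S - u2) * (S - u3) * (S - u4)) * pp * hsu
    - ((S' - v1) * (S' - v2) * (S' - v3) * (S' - v4)) * pm * hsv
    - r ^ 2 * (u1 * u2 * u3 + u1 * u2 * u4 + u1 * u3 * u4 + u2 * u3 * u4) * p * c1
    - (r * r⁻¹) * (v1 * v2 * v3 + v1 * v2 * v4 + v1 * v3 * v4 + v2 * v3 * v4) * p * c2

theorem stmt3 (q : ℝ) (hq0 : 0 < q) (hq1 : q < 1)
    (th1 th2 th3 th4 tl1 tl2 tl3 tl4 ta μ0 a : ℝ) (t1 t2 t3 t4 : ℂ)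
    (ht1 : t1 ≠ 0) (ht2 : t2 ≠ 0) (ht3 : t3 ≠ 0) (ht4 : t4 ≠ 0)
    (χ ν μ l1 l2 l3 l4 h1 h2 h3 h4 : ℝ)
    (hχ : χ = (th1 + th2 + th3 + th4 - tl1 - tl2 - tl3 - tl4) / 2)
    (hν : ν = 2 * μ0 + a - ta + χ)
    (hμ : μ = μ0 + χ + 1)
    (hl1 : l1 = th1 + μ0) (hl2 : l2 = th2 + μ0) (hl3 : l3 = th3 + μ0) (hl4 : l4 = th4 + μ0)
    (hh1 : h1 = tl1 + μ0 + χ) (hh2 : h2 = tl2 + μ0 + χ) (hh3 : h3 = tl3 + μ0 + χ)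
    (hh4 : h4 = tl4 + μ0 + χ)
    (P : ℂ → ℂ → ℂ)
    (hPa : ∀ x s : ℂ, x ≠ 0 → s ≠ 0 → P x (s / (q : ℂ)) = P ((q : ℂ) * x) s)
    (hPb : ∀ x s : ℂ, x ≠ 0 → s ≠ 0 → P x ((q : ℂ) * s) = P (x / (q : ℂ)) s)
    (hPc : ∀ x s : ℂ, x ≠ 0 → s ≠ 0 →
      (x - qpow q (μ0 - 1) * s) * P x (s / (q : ℂ)) = (x - qpow q (μ - 1) * s) * P x s)
    (hPd : ∀ x s : ℂ, x ≠ 0 → s ≠ 0 →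
      (x - qpow q μ * s) * P x ((q : ℂ) * s) = (x - qpow q μ0 * s) * P x s)
    (Φ : ℂ → ℂ → ℂ)
    (hΦ : ∀ x s : ℂ, Φ x s = x ^ ((-a : ℝ) : ℂ) * s ^ ((χ + 1 - ta : ℝ) : ℂ) * P x s)
    (x s : ℂ) (hx : x ≠ 0) (hs : s ≠ 0)
    (hres1 : x ≠ qpow q (μ0 - 1) * s) (hres2 : x ≠ qpow q μ * s) :
    A2 q t1 t2 t3 t4 h1 h2 h3 h4 l1 l2 l3 l4 a (fun y => Φ y s) x
      = qpow q ν * A2 q t1 t2 t3 t4 th1 th2 th3 th4 tl1 tl2 tl3 tl4 ta (fun u => Φ x u) s := by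
  set r := qpow q (1 / 2) with hr
  have hr0 : r ≠ 0 := qpow_ne_zero hq0 _
  have hr2 : r ^ 2 = q := qpow_half_sq hq0
  have hq1' : qpow q 1 = r ^ 2 := by rw [hr2]; simp [qpow]
  set S := qpow q (μ0 - 1) * s with hS
  set S' := qpow q μ * s with hS'
  have hS0 : S ≠ 0 := mul_ne_zero (qpow_ne_zero hq0 _) hs
  have hS'0 : S' ≠ 0 := mul_ne_zero (qpow_ne_zero hq0 _) hs
  have hsS : s / S = qpow q (1 - μ0) := by
    rw [div_eq_iff hS0, hS, ← mul_assoc, ← qpow_add hq0]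
    simp [qpow]
  have hsS' : s / S' = qpow q (-μ) := by
    rw [div_eq_iff hS'0, hS', ← mul_assoc, ← qpow_add hq0]
    simp [qpow]
  have hSS' : S / S' = qpow q (-χ - 2) := by
    rw [div_eq_iff hS'0, hS, hS', ← mul_assoc, ← qpow_add hq0, hμ]
    ring_nf
  have hS'S : S' / S = qpow q (χ + 2) := by
    rw [div_eq_iff hS0, hS, hS', ← mul_assoc, ← qpow_add hq0, hμ]
    ring_nf
  have hK : S * S' / s ^ 2 = qpow q (2 * μ0 + χ) := by
    rw [div_eq_iff (pow_ne_zero 2 hs), hS, hS', mul_mul_mul_comm, ← qpow_add hq0, hμ]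
    ring_nf
  have hu : ∀ (th l : ℝ) (t : ℂ), l = th + μ0 →
      qpow q (l - 1 / 2) * t * (s / S) = qpow q (th + 1 / 2) * t := fun th l t hl => by
    rw [hsS, mul_right_comm, ← qpow_add hq0, hl]
    ring_nf
  have hv : ∀ (tl h : ℝ) (t : ℂ), h = tl + μ0 + χ →
      qpow q (h + 1 / 2) * t * (s / S') = qpow q (tl - 1 / 2) * t := fun tl h t hh => by
    rw [hsS', mul_right_comm, ← qpow_add hq0, hh, hμ]
    ring_nf
  have hEu : qpow q ((h1 + h2 + h3 + h4 + l1 + l2 + l3 + l4) / 2) * (t1 * t2 * t3 * t4)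
      = qpow q (l1 - 1 / 2) * t1 * (qpow q (l2 - 1 / 2) * t2) * (qpow q (l3 - 1 / 2) * t3)
        * (qpow q (l4 - 1 / 2) * t4) * (S' / S) := by
    rw [hS'S, show (h1 + h2 + h3 + h4 + l1 + l2 + l3 + l4) / 2 = (l1 - 1 / 2) + (l2 - 1 / 2)
      + (l3 - 1 / 2) + (l4 - 1 / 2) + (χ + 2) by linarith]
    simp only [qpow_add hq0 _ (_ - 1 / 2), qpow_add hq0 _ (χ + 2)]
    ring
  have hEv : qpow q ((h1 + h2 + h3 + h4 + l1 + l2 + l3 + l4) / 2) * (t1 * t2 * t3 * t4)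
      = qpow q (h1 + 1 / 2) * t1 * (qpow q (h2 + 1 / 2) * t2) * (qpow q (h3 + 1 / 2) * t3)
        * (qpow q (h4 + 1 / 2) * t4) * (S / S') := by
    rw [hSS', show (h1 + h2 + h3 + h4 + l1 + l2 + l3 + l4) / 2 = (h1 + 1 / 2) + (h2 + 1 / 2)
      + (h3 + 1 / 2) + (h4 + 1 / 2) + (-χ - 2) by linarith]
    simp only [qpow_add hq0 _ (_ + 1 / 2), qpow_add hq0 _ (-χ - 2)]
    ring
  have hE : qpow q ((h1 + h2 + h3 + h4 + l1 + l2 + l3 + l4) / 2) * (t1 * t2 * t3 * t4)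
      * (s / S) ^ 2 * (s / S') ^ 2
      = qpow q ((th1 + th2 + th3 + th4 + tl1 + tl2 + tl3 + tl4) / 2) * (t1 * t2 * t3 * t4) := by
    rw [show (th1 + th2 + th3 + th4 + tl1 + tl2 + tl3 + tl4) / 2
      = (h1 + h2 + h3 + h4 + l1 + l2 + l3 + l4) / 2 + ((1 - μ0) + (1 - μ0)) + (-μ + -μ) by linarith,
      hsS, hsS', qpow_add hq0 (_ + _) (-μ + -μ), qpow_add hq0 _ ((1 - μ0) + (1 - μ0)),
      qpow_add hq0 (-μ), qpow_add hq0 (1 - μ0)]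
    ring
  have hpp : (x - S) * P x (s / q) = (x - S' / r ^ 2) * P x s := by
    rw [hPc x s hx hs, hS', ← hq1', mul_div_right_comm, div_eq_mul_inv (qpow q μ), ← qpow_neg,
      ← qpow_add hq0]
    ring_nf
  have hpm : (x - S') * P x (q * s) = (x - r ^ 2 * S) * P x s := by
    rw [hPd x s hx hs, hS, ← hq1', ← mul_assoc, ← qpow_add hq0]
    ring_nf
  have hne : ∀ (b : ℝ) {t : ℂ}, t ≠ 0 → qpow q b * t ≠ 0 := fun b _ ht =>
    mul_ne_zero (qpow_ne_zero hq0 b) ht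
  have key := kernel_identity hr0 hx hs hS0 hS'0 (sub_ne_zero.2 hres1) (sub_ne_zero.2 hres2)
    (hne _ ht1) (hne _ ht2) (hne _ ht3) (hne _ ht4) (hne _ ht1) (hne _ ht2) (hne _ ht3) (hne _ ht4)
    hEu hEv hpp hpm
  rw [hE, hu _ _ t1 hl1, hu _ _ t2 hl2, hu _ _ t3 hl3, hu _ _ t4 hl4,
    hv _ _ t1 hh1, hv _ _ t2 hh2, hv _ _ t3 hh3, hv _ _ t4 hh4, hK] at key
  rw [A2_eq_of_zeros hq0 t1 t2 t3 t4 h1 h2 h3 h4 l1 l2 l3 l4 a _ x hr rfl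
      rfl rfl rfl rfl rfl rfl rfl rfl,
    A2_eq_of_zeros hq0 t1 t2 t3 t4 th1 th2 th3 th4 tl1 tl2 tl3 tl4 ta _ s hr rfl
      rfl rfl rfl rfl rfl rfl rfl rfl]
  simp only [hΦ, div_cpow_of_pos hq0 hx, div_cpow_of_pos hq0 hs, mul_cpow_of_pos hq0 hx,
    mul_cpow_of_pos hq0 hs, ← hPa x s hx hs, ← hPb x s hx hs]
  have hb : qpow q (χ + 1 - ta) = qpow q χ * r ^ 2 * (qpow q ta)⁻¹ := by
    rw [sub_eq_add_neg, qpow_add hq0, qpow_add hq0, qpow_neg, hq1']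
  have hν' : qpow q ν = qpow q (2 * μ0 + χ) * qpow q a * (qpow q ta)⁻¹ := by
    rw [hν, ← qpow_neg, ← qpow_add hq0, ← qpow_add hq0]
    ring_nf
  have hc : S' / S = qpow q χ * r ^ 4 := by
    rw [hS'S, show χ + 2 = χ + 1 + 1 by ring, qpow_add hq0, qpow_add hq0, hq1']
    ring
  have hc' : S / S' = (qpow q χ)⁻¹ * (r ^ 4)⁻¹ := by
    rw [← inv_div, hc, mul_inv]
  rw [hc, hc'] at key
  rw [hb, hν', qpow_neg q a]
  have hA := qpow_ne_zero hq0 a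
  have hT := qpow_ne_zero hq0 ta
  generalize qpow q a = A at key hA ⊢
  generalize qpow q ta = T at key hT ⊢
  generalize x ^ ((-a : ℝ) : ℂ) = c
  generalize s ^ ((χ + 1 - ta : ℝ) : ℂ) = d
  have hA2 : A ^ 2 * A⁻¹ = A := by field_simp
  have hT1 : T⁻¹ * T = 1 := inv_mul_cancel₀ hT
  have hr4 : r ^ 2 * (r ^ 4)⁻¹ = (r ^ 2)⁻¹ := by field_simp
  generalize (x - _) * (x - _) * (x - _) * (x - _) = Q₁ at key ⊢
  generalize (x - _) * (x - _) * (x - _) * (x - _) = Q₂ at key ⊢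
  generalize (s - _) * (s - _) * (s - _) * (s - _) = Q₃ at key ⊢
  generalize (s - _) * (s - _) * (s - _) * (s - _) = Q₄ at key ⊢
  generalize -(r + r⁻¹) * x ^ 2 + _ * x + _ = B at key ⊢
  generalize -(r + r⁻¹) * s ^ 2 + _ * s + _ = B' at key ⊢
  simp only [mul_inv, inv_inv]
  rw [← hr4]
  linear_combination A * c * d * key + r ^ 2 * x⁻¹ ^ 2 * Q₂ * c * d * P x (s / q) * hA2
    - qpow q (2 * μ0 + χ) * A * c * d * (s⁻¹ ^ 2 * Q₃ * (qpow q χ)⁻¹ * r ^ 2 * (r ^ 4)⁻¹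
      * P x (s / q) + r * B' * P x s
      + (T⁻¹ * T + 1) * r ^ 4 * s⁻¹ ^ 2 * Q₄ * qpow q χ * P x (q * s)) * hT1
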